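/- (Lemma 5.3) Let C_ε = inf_{v ∈ V} 𝓔(v) (which is finite, since 𝓔 ≥ 0 on V). Then for every v ∈ V, (1/ε)∫₀^ε |v(φ(y),y) − v̄(0)| dy ≤ (2/(1−ν))·( (1+H)·ε + 𝓔(v) − C_ε ), where v̄(x) = (1/ε)∫₀^ε v(x,ŷ) dŷ is the y-average of v. -/

import Mathlib

open MeasureTheory Set

noncomputable section

/-- The `x`-partial derivative of a function on `ℝ × ℝ`. -/
def pdx (v : ℝ × ℝ → ℝ) (p : ℝ × ℝ) : ℝ := fderiv ℝ v p (1, 0)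

/-- The `y`-partial derivative of a function on `ℝ × ℝ`. -/
def pdy (v : ℝ × ℝ → ℝ) (p : ℝ × ℝ) : ℝ := fderiv ℝ v p (0, 1)

/-- The squared norm of the (a.e.-defined) gradient `|∇v|²`. -/
def gradSq (v : ℝ × ℝ → ℝ) (p : ℝ × ℝ) : ℝ := (pdx v p) ^ 2 + (pdy v p) ^ 2

/-- The open domain `D = {(x,y) : φ(y) < x < 1, 0 < y < ε}`. -/
def Dom (ε : ℝ) (φ : ℝ → ℝ) : Set (ℝ × ℝ) :=
  {p | φ p.2 < p.1 ∧ p.1 < 1 ∧ 0 < p.2 ∧ p.2 < ε}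

/-- The closed strip `D̄ = {(x,y) : φ(y) ≤ x ≤ 1}`. -/
def DomBar (φ : ℝ → ℝ) : Set (ℝ × ℝ) := {p | φ p.2 ≤ p.1 ∧ p.1 ≤ 1}

/-- The admissible class `V`: Lipschitz functions on `D̄`, `ε`-periodic in `y`,
vanishing on `x = 1`. -/
def memV (ε : ℝ) (φ : ℝ → ℝ) (v : ℝ × ℝ → ℝ) : Prop :=
  (∃ K : NNReal, LipschitzOnWith K v (DomBar φ)) ∧
  (∀ x y : ℝ, v (x, y + ε) = v (x, y)) ∧
  (∀ y : ℝ, v (1, y) = 0)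

/-- The capillary energy functional `𝓔`. -/
def En (ε : ℝ) (φ c : ℝ → ℝ) (v : ℝ × ℝ → ℝ) : ℝ :=
  (1 / ε) * (∫ p in Dom ε φ, Real.sqrt (1 + gradSq v p)) -
  (1 / ε) * (∫ y in Ioo (0 : ℝ) ε,
    v (φ y, y) * c y * Real.sqrt (1 + (deriv φ y) ^ 2))

/-- First component of the field `∇v / √(1 + |∇v|²)`. -/
def F1 (v : ℝ × ℝ → ℝ) (p : ℝ × ℝ) : ℝ := pdx v p / Real.sqrt (1 + gradSq v p)

/-- Second component of the field `∇v / √(1 + |∇v|²)`. -/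
def F2 (v : ℝ × ℝ → ℝ) (p : ℝ × ℝ) : ℝ := pdy v p / Real.sqrt (1 + gradSq v p)

/-- A capillary solution: a member of `V`, `C²` on `D̄`, solving the minimal surface
equation in `D` and the contact-angle condition on the left boundary. -/
def IsCapillary (ε : ℝ) (φ c : ℝ → ℝ) (u : ℝ × ℝ → ℝ) : Prop :=
  memV ε φ u ∧ ContDiffOn ℝ 2 u (DomBar φ) ∧
  (∀ p ∈ Dom ε φ, pdx (F1 u) p + pdy (F2 u) p = 0) ∧
  (∀ y : ℝ, pdx u (φ y, y) - pdy u (φ y, y) * deriv φ y =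
    - c y * Real.sqrt (1 + gradSq u (φ y, y)) * Real.sqrt (1 + (deriv φ y) ^ 2))

/-- The `y`-average `v̄(x) = (1/ε) ∫₀^ε v(x,y) dy`. -/
def ybar (ε : ℝ) (v : ℝ × ℝ → ℝ) (x : ℝ) : ℝ := (1 / ε) * ∫ y in Ioo (0 : ℝ) ε, v (x, y)

/-- The cosine of the apparent contact angle,
`cos θₐ = (1/ε) ∫₀^ε c(y) √(1 + φ'(y)²) dy`. -/
def cosA (ε : ℝ) (φ c : ℝ → ℝ) : ℝ :=
  (1 / ε) * ∫ y in Ioo (0 : ℝ) ε, c y * Real.sqrt (1 + (deriv φ y) ^ 2)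

/-- The one-dimensional energy `E_β(w) = ∫₀¹ √(1 + w'(x)²) dx − β w(0)`. -/
def En1 (β : ℝ) (w : ℝ → ℝ) : ℝ :=
  (∫ x in Ioo (0 : ℝ) 1, Real.sqrt (1 + (deriv w x) ^ 2)) - w 0 * β

/-- The standard context hypotheses on the data `ε, ν, H, φ, c`. -/
def Ctx (ε ν H : ℝ) (φ c : ℝ → ℝ) : Prop :=
  ε ∈ Ioc (0 : ℝ) 1 ∧ ν ∈ Ico (0 : ℝ) 1 ∧ 0 ≤ H ∧
  ContDiff ℝ 1 φ ∧ (∀ y, φ (y + ε) = φ y) ∧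
  (∀ y, -(ε * H) ≤ φ y) ∧ (∀ y, φ y ≤ 0) ∧
  Continuous c ∧ (∀ y, c (y + ε) = c y) ∧
  (∀ y, |c y| * Real.sqrt (1 + (deriv φ y) ^ 2) ≤ ν)

theorem intervalIntegrable_slice {F : ℝ × ℝ → ℝ} {M : ℝ} (hF : Measurable F)
    (hM : ∀ p, |F p| ≤ M) (y a b : ℝ) :
    IntervalIntegrable (fun x => F (x, y)) volume a b :=
  (intervalIntegrable_const (c := M)).mono_fun'
    (hF.comp measurable_prodMk_right).aestronglyMeasurable
    (Filter.Eventually.of_forall fun x => hM (x, y))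

theorem measurable_integral_slice {F : ℝ × ℝ → ℝ} (hF : Measurable F) {a b : ℝ → ℝ}
    (ha : Continuous a) (hb : Continuous b) :
    Measurable fun y => ∫ x in a y..b y, F (x, y) := by
  have key : ∀ {a b : ℝ → ℝ}, Continuous a → Continuous b →
      Measurable fun y => ∫ x in Ioc (a y) (b y), F (x, y) := by
    intro a b ha hb
    have hS : MeasurableSet {p : ℝ × ℝ | a p.2 < p.1 ∧ p.1 ≤ b p.2} :=
      (measurableSet_lt (ha.measurable.comp measurable_snd) measurable_fst).inter
        (measurableSet_le measurable_fst (hb.measurable.comp measurable_snd))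
    have h := ((hF.indicator hS).stronglyMeasurable.integral_prod_left'
      (μ := (volume : Measure ℝ))).measurable
    refine (congrArg Measurable (funext fun y => ?_)).mp h
    rw [← integral_indicator measurableSet_Ioc]
    rfl
  simp only [intervalIntegral]
  exact (key ha hb).sub (key hb ha)

theorem intervalIntegrable_integral_slice {F : ℝ × ℝ → ℝ} {M : ℝ} (hF : Measurable F)
    (hM : ∀ p, |F p| ≤ M) {a b : ℝ → ℝ} (ha : Continuous a) (hb : Continuous b) (c d : ℝ) :
    IntervalIntegrable (fun y => ∫ x in a y..b y, F (x, y)) volume c d := by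
  have hc : Continuous fun y => M * |b y - a y| := by fun_prop
  refine (hc.intervalIntegrable c d).mono_fun'
    (measurable_integral_slice hF ha hb).aestronglyMeasurable
    (Filter.Eventually.of_forall fun y => ?_)
  exact intervalIntegral.norm_integral_le_of_norm_le_const fun x _ => hM (x, y)

theorem isOpen_Dom {ε : ℝ} {φ : ℝ → ℝ} (hφ : Continuous φ) : IsOpen (Dom ε φ) :=
  (isOpen_lt (hφ.comp continuous_snd) continuous_fst).inter
    ((isOpen_lt continuous_fst continuous_const).inter
      ((isOpen_lt continuous_const continuous_snd).inter
        (isOpen_lt continuous_snd continuous_const)))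

theorem setIntegral_Dom {F : ℝ × ℝ → ℝ} {M m ε : ℝ} {φ : ℝ → ℝ} (hF : Measurable F)
    (hM : ∀ p, |F p| ≤ M) (hφ : Continuous φ) (hm : ∀ y, m ≤ φ y) (h1 : ∀ y, φ y ≤ 1)
    (hε : 0 ≤ ε) :
    ∫ p in Dom ε φ, F p = ∫ y in (0 : ℝ)..ε, ∫ x in φ y..1, F (x, y) := by
  have hmeas : MeasurableSet (Dom ε φ) := (isOpen_Dom hφ).measurableSet
  have hsub : Dom ε φ ⊆ Icc m 1 ×ˢ Icc 0 ε := fun p hp =>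
    ⟨⟨(hm _).trans hp.1.le, hp.2.1.le⟩, hp.2.2.1.le, hp.2.2.2.le⟩
  have hfin : volume (Dom ε φ) < ⊤ :=
    (measure_mono hsub).trans_lt (isCompact_Icc.prod isCompact_Icc).measure_lt_top
  have hint : IntegrableOn F (Dom ε φ) :=
    Measure.integrableOn_of_bounded hfin.ne hF.aestronglyMeasurable
      (Filter.Eventually.of_forall hM)
  rw [← integral_indicator hmeas, Measure.volume_eq_prod, integral_prod_symm _
    (by rw [← Measure.volume_eq_prod]; exact (integrable_indicator_iff hmeas).2 hint),
    intervalIntegral.integral_of_le hε, integral_Ioc_eq_integral_Ioo,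
    ← integral_indicator measurableSet_Ioo]
  congr 1 with y
  by_cases hy : y ∈ Ioo 0 ε
  · rw [indicator_of_mem hy, intervalIntegral.integral_of_le (h1 y), integral_Ioc_eq_integral_Ioo,
      ← integral_indicator measurableSet_Ioo]
    congr 1 with x
    by_cases hx : x ∈ Ioo (φ y) 1
    · rw [indicator_of_mem hx, indicator_of_mem]
      exact ⟨hx.1, hx.2, hy.1, hy.2⟩
    · rw [indicator_of_notMem hx, indicator_of_notMem]
      exact fun h => hx ⟨h.1, h.2.1⟩
  · rw [indicator_of_notMem hy]
    refine integral_eq_zero_of_ae (Filter.Eventually.of_forall fun x => ?_)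
    exact indicator_of_notMem (fun h => hy ⟨h.2.2.1, h.2.2.2⟩) _

section Lipschitz

variable {g : ℝ × ℝ → ℝ} {K : NNReal}

theorem measurable_pdx (g : ℝ × ℝ → ℝ) : Measurable (pdx g) :=
  measurable_fderiv_apply_const ℝ g _

theorem measurable_pdy (g : ℝ × ℝ → ℝ) : Measurable (pdy g) :=
  measurable_fderiv_apply_const ℝ g _

theorem measurable_sqrt_gradSq (g : ℝ × ℝ → ℝ) :
    Measurable fun p => Real.sqrt (1 + gradSq g p) :=
  (measurable_const.add (((measurable_pdx g).pow_const 2).add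
    ((measurable_pdy g).pow_const 2))).sqrt

theorem abs_pdx_le (hg : LipschitzWith K g) (p : ℝ × ℝ) : |pdx g p| ≤ K := by
  have h := (fderiv ℝ g p).le_of_opNorm_le (norm_fderiv_le_of_lipschitz ℝ hg) (1, 0)
  simpa [pdx, Prod.norm_def] using h

theorem abs_pdy_le (hg : LipschitzWith K g) (p : ℝ × ℝ) : |pdy g p| ≤ K := by
  have h := (fderiv ℝ g p).le_of_opNorm_le (norm_fderiv_le_of_lipschitz ℝ hg) (0, 1)
  simpa [pdy, Prod.norm_def] using h

theorem abs_sqrt_gradSq_le (hg : LipschitzWith K g) (p : ℝ × ℝ) :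
    |Real.sqrt (1 + gradSq g p)| ≤ Real.sqrt (1 + ((K : ℝ) ^ 2 + (K : ℝ) ^ 2)) := by
  rw [abs_of_nonneg (Real.sqrt_nonneg _)]
  refine Real.sqrt_le_sqrt (add_le_add_right (add_le_add ?_ ?_) 1)
  · exact sq_le_sq' (abs_le.1 (abs_pdx_le hg p)).1 (abs_le.1 (abs_pdx_le hg p)).2
  · exact sq_le_sq' (abs_le.1 (abs_pdy_le hg p)).1 (abs_le.1 (abs_pdy_le hg p)).2

theorem abs_pdx_le_sqrt_gradSq (g : ℝ × ℝ → ℝ) (p : ℝ × ℝ) :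
    |pdx g p| ≤ Real.sqrt (1 + gradSq g p) := by
  refine Real.abs_le_sqrt ?_
  simp only [gradSq]
  nlinarith [sq_nonneg (pdy g p)]

theorem abs_add_abs_sub_le_sqrt_gradSq (g : ℝ × ℝ → ℝ) (p : ℝ × ℝ) {σ : ℝ} (hσ : |σ| ≤ 1) :
    |pdx g p + σ * pdy g p| + |pdx g p - σ * pdy g p| ≤ 2 * Real.sqrt (1 + gradSq g p) := by
  have hx := abs_pdx_le_sqrt_gradSq g p
  have hy : |σ * pdy g p| ≤ Real.sqrt (1 + gradSq g p) := by
    rw [abs_mul]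
    refine (mul_le_of_le_one_left (abs_nonneg _) hσ).trans (Real.abs_le_sqrt ?_)
    simp only [gradSq]
    nlinarith [sq_nonneg (pdx g p)]
  rw [abs_le] at hx hy
  rcases abs_cases (pdx g p + σ * pdy g p) with h | h <;>
    rcases abs_cases (pdx g p - σ * pdy g p) with h' | h' <;> linarith [h.1, h'.1]

theorem ae_ae_differentiableAt (hg : LipschitzWith K g) :
    ∀ᵐ y : ℝ, ∀ᵐ x : ℝ, DifferentiableAt ℝ g (x, y) := by
  have h : ∀ᵐ p : ℝ × ℝ, DifferentiableAt ℝ g p := hg.ae_differentiableAt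
  rw [Measure.volume_eq_prod] at h
  exact (Measure.ae_ae_comm (p := fun x y => DifferentiableAt ℝ g (x, y))
    (measurableSet_of_differentiableAt ℝ g)).1 (Measure.ae_ae_of_ae_prod h)

theorem deriv_slice {x y : ℝ} (h : DifferentiableAt ℝ g (x, y)) :
    deriv (fun t => g (t, y)) x = pdx g (x, y) :=
  (h.hasFDerivAt.comp_hasDerivAt x ((hasDerivAt_id x).prodMk (hasDerivAt_const x y))).deriv

theorem ae_abs_sub_le_integral_pdx (hg : LipschitzWith K g) :
    ∀ᵐ y : ℝ, ∀ a b : ℝ, a ≤ b → |g (b, y) - g (a, y)| ≤ ∫ x in a..b, |pdx g (x, y)| := by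
  filter_upwards [ae_ae_differentiableAt hg] with y hy a b hab
  have hl : LipschitzWith K fun x => g (x, y) := by
    simpa [Function.comp_def] using hg.comp (LipschitzWith.prodMk_right y)
  rw [← ((hl.lipschitzOnWith (s := uIcc a b)).absolutelyContinuousOnInterval).integral_deriv_eq_sub,
    intervalIntegral.integral_congr_ae (g := fun x => pdx g (x, y))
      (hy.mono fun x hx _ => deriv_slice hx)]
  exact intervalIntegral.abs_integral_le_integral_abs hab

theorem integral_abs_sub_le (hg : LipschitzWith K g) {a b : ℝ → ℝ} (ha : Continuous a)
    (hb : Continuous b) (hab : ∀ y, a y ≤ b y) {c d : ℝ} (hcd : c ≤ d) :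
    ∫ y in c..d, |g (b y, y) - g (a y, y)| ≤
      ∫ y in c..d, ∫ x in a y..b y, |pdx g (x, y)| := by
  have hc := hg.continuous
  refine intervalIntegral.integral_mono_ae hcd
    (Continuous.intervalIntegrable (by fun_prop) _ _)
    (intervalIntegrable_integral_slice (F := fun p => |pdx g p|) (M := K)
      (measurable_pdx g).abs (fun p => by simpa using abs_pdx_le hg p) ha hb c d) ?_
  filter_upwards [ae_abs_sub_le_integral_pdx hg] with y hy using hy _ _ (hab y)

/-- The linear shear `(x, y) ↦ (x, y + σ x)` of the plane. -/
def shear (σ : ℝ) : (ℝ × ℝ) ≃L[ℝ] (ℝ × ℝ) :=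
  ContinuousLinearEquiv.equivOfInverse
    ((ContinuousLinearMap.fst ℝ ℝ ℝ).prod
      (ContinuousLinearMap.snd ℝ ℝ ℝ + σ • ContinuousLinearMap.fst ℝ ℝ ℝ))
    ((ContinuousLinearMap.fst ℝ ℝ ℝ).prod
      (ContinuousLinearMap.snd ℝ ℝ ℝ - σ • ContinuousLinearMap.fst ℝ ℝ ℝ))
    (fun p => by ext <;> simp) (fun p => by ext <;> simp)

theorem shear_apply (σ x y : ℝ) : shear σ (x, y) = (x, y + σ * x) := by
  simp [shear]

theorem pdx_comp_shear (g : ℝ × ℝ → ℝ) (σ x y : ℝ) :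
    pdx (g ∘ shear σ) (x, y) = pdx g (x, y + σ * x) + σ * pdy g (x, y + σ * x) := by
  have h : shear σ (1, 0) = (1, 0) + σ • (0, 1) := by simp [shear_apply]
  simp only [pdx, pdy, (shear σ).comp_right_fderiv, shear_apply, ContinuousLinearMap.comp_apply,
    ContinuousLinearEquiv.coe_coe, h, map_add, map_smul, smul_eq_mul]

theorem periodic_fderiv {ε : ℝ} (hper : ∀ x y : ℝ, g (x, y + ε) = g (x, y)) (x y : ℝ) :
    fderiv ℝ g (x, y + ε) = fderiv ℝ g (x, y) := by
  have h := fderiv_comp_add_right (𝕜 := ℝ) (f := g) (x := (x, y)) ((0, ε) : ℝ × ℝ)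
  have h' : (fun p : ℝ × ℝ => g (p + (0, ε))) = g := by
    ext ⟨a, b⟩
    simpa using hper a b
  rw [h'] at h
  simpa using h.symm

theorem integral_abs_sub_shear_le {ε : ℝ} (hg : LipschitzWith K g) (hε : 0 ≤ ε)
    (hper : ∀ x y : ℝ, g (x, y + ε) = g (x, y)) (σ : ℝ) :
    ∫ y in (0 : ℝ)..ε, |g (ε, y + σ * ε) - g (0, y)| ≤
      ∫ y in (0 : ℝ)..ε, ∫ x in (0 : ℝ)..ε, |pdx g (x, y) + σ * pdy g (x, y)| := by
  have swap : ∀ {F : ℝ × ℝ → ℝ} {M : ℝ}, Measurable F → (∀ p, |F p| ≤ M) →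
      ∫ y in (0 : ℝ)..ε, ∫ x in (0 : ℝ)..ε, F (x, y) =
        ∫ x in (0 : ℝ)..ε, ∫ y in (0 : ℝ)..ε, F (x, y) := by
    intro F M hF hM
    refine intervalIntegral_intervalIntegral_swap (F := fun y x => F (x, y)) ?_
    refine Measure.integrableOn_of_bounded (M := M) ?_
      (hF.comp measurable_swap).aestronglyMeasurable
      (Filter.Eventually.of_forall fun p => hM (p.2, p.1))
    rw [uIoc_of_le hε]
    exact ((measure_mono (prod_mono Ioc_subset_Icc_self Ioc_subset_Icc_self)).trans_lt
      (isCompact_Icc.prod isCompact_Icc).measure_lt_top).ne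
  have hL : LipschitzWith (K * ‖(shear σ : ℝ × ℝ →L[ℝ] ℝ × ℝ)‖₊) (g ∘ shear σ) :=
    hg.comp (shear σ : ℝ × ℝ →L[ℝ] ℝ × ℝ).lipschitz
  have h := integral_abs_sub_le hL continuous_const continuous_const (fun _ => hε) hε
    (a := fun _ => 0) (b := fun _ => ε)
  simp only [Function.comp_apply, shear_apply, mul_zero, add_zero] at h
  refine h.trans_eq ?_
  rw [swap (F := fun p => |pdx (g ∘ shear σ) p|) (measurable_pdx _).abs
      (fun p => by simpa only [abs_abs] using abs_pdx_le hL p),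
    swap (F := fun p => |pdx g p + σ * pdy g p|) (M := K + |σ| * K)
      ((measurable_pdx _).add ((measurable_pdy _).const_mul σ)).abs
      (fun p => by
        rw [abs_abs]
        refine (abs_add_le _ _).trans (add_le_add (abs_pdx_le hg p) ?_)
        rw [abs_mul]
        exact mul_le_mul_of_nonneg_left (abs_pdy_le hg p) (abs_nonneg _))]
  refine intervalIntegral.integral_congr fun x _ => ?_
  simp only [pdx_comp_shear]
  have hp : Function.Periodic (fun y => |pdx g (x, y) + σ * pdy g (x, y)|) ε := fun y => by
    simp only [pdx, pdy, periodic_fderiv hper]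
  rw [intervalIntegral.integral_comp_add_right (fun y => |pdx g (x, y) + σ * pdy g (x, y)|)]
  simpa [add_comm] using hp.intervalIntegral_add_eq (σ * x) 0

end Lipschitz

theorem exists_lipschitzWith_of_memV {ε : ℝ} {φ : ℝ → ℝ} {v : ℝ × ℝ → ℝ} (hε : ε ≠ 0)
    (hφ : ContDiff ℝ 1 φ) (hper : ∀ y, φ (y + ε) = φ y) (h1 : ∀ y, φ y ≤ 1)
    (hv : memV ε φ v) :
    ∃ (K : NNReal) (g : ℝ × ℝ → ℝ), LipschitzWith K g ∧ memV ε φ g ∧ EqOn g v (DomBar φ) := by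
  obtain ⟨⟨K, hK⟩, hvper, hv1⟩ := hv
  have hdc : Continuous (deriv φ) := hφ.continuous_deriv le_rfl
  have hdper : Function.Periodic (deriv φ) ε := fun y => by
    rw [← deriv_comp_add_const]
    simp only [hper]
  obtain ⟨R, hR⟩ := (hdper.isBounded_of_continuous hε hdc).exists_norm_le
  have hφL : LipschitzWith R.toNNReal φ :=
    lipschitzWith_of_nnnorm_deriv_le (hφ.differentiable one_ne_zero) fun x =>
      NNReal.coe_le_coe.1 ((hR _ (mem_range_self x)).trans (Real.le_coe_toNNReal R))
  let clamp : ℝ × ℝ → ℝ × ℝ := fun p => (max (φ p.2) (min p.1 1), p.2)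
  have hclamp : ∃ L, LipschitzWith L clamp :=
    ⟨_, ((hφL.comp LipschitzWith.prod_snd).max
      (LipschitzWith.prod_fst.min_const 1)).prodMk LipschitzWith.prod_snd⟩
  obtain ⟨L, hL⟩ := hclamp
  have hmem : ∀ p, clamp p ∈ DomBar φ := fun p =>
    ⟨le_max_left _ _, max_le (h1 _) (min_le_right _ _)⟩
  have hcomp : LipschitzWith (K * L) (v ∘ clamp) :=
    lipschitzOnWith_univ.1 (hK.comp (hL.lipschitzOnWith (s := univ)) fun p _ => hmem p)
  refine ⟨K * L, v ∘ clamp, hcomp, ⟨⟨_, hcomp.lipschitzOnWith⟩, fun x y => ?_, fun y => ?_⟩,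
    fun p hp => ?_⟩
  · simp only [Function.comp_apply, clamp, hper, hvper]
  · simp only [Function.comp_apply, clamp, min_self, max_eq_right (h1 y), hv1]
  · simp only [Function.comp_apply, clamp, min_eq_left hp.2, max_eq_right hp.1]

theorem En_congr {ε : ℝ} {φ c : ℝ → ℝ} {g v : ℝ × ℝ → ℝ} (hφ : Continuous φ)
    (h1 : ∀ y, φ y ≤ 1) (h : EqOn g v (DomBar φ)) : En ε φ c g = En ε φ c v := by
  have hgrad : ∀ p ∈ Dom ε φ, Real.sqrt (1 + gradSq g p) = Real.sqrt (1 + gradSq v p) := by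
    intro p hp
    have hev : g =ᶠ[nhds p] v :=
      Filter.eventually_of_mem ((isOpen_Dom hφ).mem_nhds hp) fun q hq =>
        h ⟨hq.1.le, hq.2.1.le⟩
    simp only [gradSq, pdx, pdy, hev.fderiv_eq]
  have hb : ∀ y, g (φ y, y) = v (φ y, y) := fun y => h ⟨le_rfl, h1 y⟩
  simp only [En, setIntegral_congr_fun (isOpen_Dom hφ).measurableSet hgrad, hb]

theorem En_eq {ε m : ℝ} {φ c : ℝ → ℝ} {g : ℝ × ℝ → ℝ} {K : NNReal} (hg : LipschitzWith K g)
    (hφ : Continuous φ) (hm : ∀ y, m ≤ φ y) (h1 : ∀ y, φ y ≤ 1) (hε : 0 ≤ ε) :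
    En ε φ c g =
      (1 / ε) * (∫ y in (0 : ℝ)..ε, ∫ x in φ y..1, Real.sqrt (1 + gradSq g (x, y))) -
      (1 / ε) * ∫ y in (0 : ℝ)..ε,
        g (φ y, y) * (c y * Real.sqrt (1 + (deriv φ y) ^ 2)) := by
  rw [En, setIntegral_Dom (measurable_sqrt_gradSq g) (abs_sqrt_gradSq_le hg) hφ hm h1 hε,
    intervalIntegral.integral_of_le hε, intervalIntegral.integral_of_le hε,
    integral_Ioc_eq_integral_Ioo (f := fun y => g (φ y, y) * _)]
  simp only [mul_assoc]

theorem integral_slice_mono {F G : ℝ × ℝ → ℝ} {M M' : ℝ} (hF : Measurable F)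
    (hM : ∀ p, |F p| ≤ M) (hG : Measurable G) (hM' : ∀ p, |G p| ≤ M') {a b : ℝ → ℝ}
    (ha : Continuous a) (hb : Continuous b) (hab : ∀ y, a y ≤ b y) {c d : ℝ} (hcd : c ≤ d)
    (h : ∀ p, F p ≤ G p) :
    ∫ y in c..d, ∫ x in a y..b y, F (x, y) ≤ ∫ y in c..d, ∫ x in a y..b y, G (x, y) :=
  intervalIntegral.integral_mono_on hcd (intervalIntegrable_integral_slice hF hM ha hb c d)
    (intervalIntegrable_integral_slice hG hM' ha hb c d) fun y _ =>
    intervalIntegral.integral_mono_on (hab y) (intervalIntegrable_slice hF hM y _ _)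
      (intervalIntegrable_slice hG hM' y _ _) fun x _ => h (x, y)

theorem integral_slice_add {F : ℝ × ℝ → ℝ} {M : ℝ} (hF : Measurable F)
    (hM : ∀ p, |F p| ≤ M) {a b e : ℝ → ℝ}
    (ha : Continuous a) (hb : Continuous b) (he : Continuous e) (c d : ℝ) :
    ∫ y in c..d, ∫ x in a y..e y, F (x, y) =
      (∫ y in c..d, ∫ x in a y..b y, F (x, y)) + ∫ y in c..d, ∫ x in b y..e y, F (x, y) := by
  rw [← intervalIntegral.integral_add (intervalIntegrable_integral_slice hF hM ha hb c d)
    (intervalIntegrable_integral_slice hF hM hb he c d)]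
  refine intervalIntegral.integral_congr fun y _ => ?_
  exact (intervalIntegral.integral_add_adjacent_intervals (intervalIntegrable_slice hF hM y _ _)
    (intervalIntegrable_slice hF hM y _ _)).symm

theorem integral_abs_sub_le_sqrt_gradSq {g : ℝ × ℝ → ℝ} {K : NNReal} (hg : LipschitzWith K g)
    {a b : ℝ → ℝ} (ha : Continuous a) (hb : Continuous b) (hab : ∀ y, a y ≤ b y)
    {c d : ℝ} (hcd : c ≤ d) :
    ∫ y in c..d, |g (b y, y) - g (a y, y)| ≤
      ∫ y in c..d, ∫ x in a y..b y, Real.sqrt (1 + gradSq g (x, y)) :=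
  (integral_abs_sub_le hg ha hb hab hcd).trans
    (integral_slice_mono (F := fun p => |pdx g p|) (measurable_pdx g).abs
      (fun p => by simpa only [abs_abs] using abs_pdx_le hg p) (measurable_sqrt_gradSq g)
      (abs_sqrt_gradSq_le hg) ha hb hab hcd (abs_pdx_le_sqrt_gradSq g))

theorem integral_mul_le_of_abs_le {f k : ℝ → ℝ} {ν a b : ℝ} (hf : Continuous f)
    (hk : Continuous k) (hν : ∀ y, |k y| ≤ ν) (hab : a ≤ b) :
    ∫ y in a..b, f y * k y ≤ ν * ∫ y in a..b, |f y| := by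
  rw [← intervalIntegral.integral_const_mul]
  refine intervalIntegral.integral_mono_on hab (Continuous.intervalIntegrable (by fun_prop) _ _)
    (Continuous.intervalIntegrable (by fun_prop) _ _) fun y _ => ?_
  calc f y * k y ≤ |f y| * |k y| := by rw [← abs_mul]; exact le_abs_self _
    _ ≤ |f y| * ν := mul_le_mul_of_nonneg_left (hν y) (abs_nonneg _)
    _ = ν * |f y| := mul_comm _ _

theorem integral_slice_nonneg {F : ℝ × ℝ → ℝ} (hF : ∀ p, 0 ≤ F p) {a b : ℝ → ℝ}
    (hab : ∀ y, a y ≤ b y) {c d : ℝ} (hcd : c ≤ d) :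
    0 ≤ ∫ y in c..d, ∫ x in a y..b y, F (x, y) :=
  intervalIntegral.integral_nonneg hcd fun y _ =>
    intervalIntegral.integral_nonneg (hab y) fun x _ => hF (x, y)

theorem En_nonneg {ε ν m : ℝ} {φ c : ℝ → ℝ} {g : ℝ × ℝ → ℝ} {K : NNReal}
    (hg : LipschitzWith K g) (hg1 : ∀ y, g (1, y) = 0) (hφ : Continuous φ)
    (hm : ∀ y, m ≤ φ y) (h1 : ∀ y, φ y ≤ 1) (hε : 0 ≤ ε)
    (hk : Continuous fun y => c y * Real.sqrt (1 + (deriv φ y) ^ 2))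
    (hν : ∀ y, |c y * Real.sqrt (1 + (deriv φ y) ^ 2)| ≤ ν) (hν1 : ν ≤ 1) :
    0 ≤ En ε φ c g := by
  have hgc := hg.continuous
  rw [En_eq hg hφ hm h1 hε, ← mul_sub]
  refine mul_nonneg (by positivity) (sub_nonneg.2 ?_)
  have hA := integral_abs_sub_le_sqrt_gradSq hg hφ continuous_const h1 hε (b := fun _ => 1)
  simp only [hg1, zero_sub, abs_neg] at hA
  have hB := integral_mul_le_of_abs_le (f := fun y => g (φ y, y)) (by fun_prop) hk hν hε
  have hC : 0 ≤ ∫ y in (0 : ℝ)..ε, |g (φ y, y)| :=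
    intervalIntegral.integral_nonneg hε fun y _ => abs_nonneg _
  nlinarith

/-- The function of `x` alone that follows the slice of `g` at height `y₀` to the right of
`x = ε` and is constant to the left of it. -/
def sliceExt (ε : ℝ) (g : ℝ × ℝ → ℝ) (y₀ : ℝ) (p : ℝ × ℝ) : ℝ := g (max p.1 ε, y₀)

theorem lipschitzWith_sliceExt {g : ℝ × ℝ → ℝ} {K : NNReal} (hg : LipschitzWith K g)
    (ε y₀ : ℝ) : LipschitzWith K (sliceExt ε g y₀) := by
  have h := hg.comp ((LipschitzWith.prodMk_right y₀).comp
    ((LipschitzWith.prod_fst (α := ℝ) (β := ℝ)).max_const ε))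
  rw [mul_one, mul_one] at h
  exact h

theorem gradSq_sliceExt_of_lt (g : ℝ × ℝ → ℝ) {ε x : ℝ} (y₀ y : ℝ) (hx : x < ε) :
    gradSq (sliceExt ε g y₀) (x, y) = 0 := by
  have hev : sliceExt ε g y₀ =ᶠ[nhds (x, y)] fun _ => g (ε, y₀) :=
    Filter.eventually_of_mem ((isOpen_lt continuous_fst continuous_const).mem_nhds hx)
      fun p (hp : p.1 < ε) => by simp only [sliceExt, max_eq_right hp.le]
  simp [gradSq, pdx, pdy, hev.fderiv_eq]

theorem gradSq_sliceExt_le_of_gt {g : ℝ × ℝ → ℝ} {ε x y₀ : ℝ} (y : ℝ) (hx : ε < x)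
    (hd : DifferentiableAt ℝ g (x, y₀)) :
    gradSq (sliceExt ε g y₀) (x, y) ≤ gradSq g (x, y₀) := by
  have hev : sliceExt ε g y₀ =ᶠ[nhds (x, y)] g ∘ fun p => (p.1, y₀) :=
    Filter.eventually_of_mem ((isOpen_lt continuous_const continuous_fst).mem_nhds hx)
      fun p (hp : ε < p.1) => by
        simp only [sliceExt, max_eq_left hp.le, Function.comp_apply]
  have hl : HasFDerivAt (fun p : ℝ × ℝ => (p.1, y₀))
      ((ContinuousLinearMap.fst ℝ ℝ ℝ).prod 0) (x, y) :=
    hasFDerivAt_fst.prodMk (hasFDerivAt_const _ _)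
  have hc := (hd.hasFDerivAt.comp (x, y) hl).fderiv
  simp only [gradSq, pdx, pdy, hev.fderiv_eq, hc, ContinuousLinearMap.comp_apply]
  have h00 : fderiv ℝ g (x, y₀) (0, 0) = 0 := map_zero _
  simpa [h00] using sq_nonneg (fderiv ℝ g (x, y₀) (0, 1))

theorem ae_En_sliceExt_le {ε H : ℝ} {φ c : ℝ → ℝ} {g : ℝ × ℝ → ℝ} {K : NNReal}
    (hg : LipschitzWith K g) (hφ : Continuous φ) (hm : ∀ y, -(ε * H) ≤ φ y)
    (h0 : ∀ y, φ y ≤ 0) (hε : 0 < ε) (hε1 : ε ≤ 1) :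
    ∀ᵐ y₀ : ℝ, En ε φ c (sliceExt ε g y₀) ≤
      ε * (1 + H) + (∫ x in ε..1, Real.sqrt (1 + gradSq g (x, y₀))) -
        g (ε, y₀) * ((1 / ε) * ∫ y in (0 : ℝ)..ε, c y * Real.sqrt (1 + (deriv φ y) ^ 2)) := by
  filter_upwards [ae_ae_differentiableAt hg] with y₀ hy₀
  have hw := lipschitzWith_sliceExt hg ε y₀
  have hb : ∀ y, sliceExt ε g y₀ (φ y, y) = g (ε, y₀) := fun y => by
    simp only [sliceExt, max_eq_right ((h0 y).trans hε.le)]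
  rw [En_eq hw hφ hm (fun y => (h0 y).trans zero_le_one) hε.le]
  simp only [hb, intervalIntegral.integral_const_mul]
  have hwm := measurable_sqrt_gradSq (sliceExt ε g y₀)
  have hwM := abs_sqrt_gradSq_le hw
  have hgm := measurable_sqrt_gradSq g
  have hgM := abs_sqrt_gradSq_le hg
  have hinner : ∀ y, ∫ x in φ y..1, Real.sqrt (1 + gradSq (sliceExt ε g y₀) (x, y)) ≤
      ε * (1 + H) + ∫ x in ε..1, Real.sqrt (1 + gradSq g (x, y₀)) := by
    intro y
    rw [← intervalIntegral.integral_add_adjacent_intervals (b := ε)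
      (intervalIntegrable_slice hwm hwM y _ _) (intervalIntegrable_slice hwm hwM y _ _)]
    refine add_le_add ?_ ?_
    · have : ∫ x in φ y..ε, Real.sqrt (1 + gradSq (sliceExt ε g y₀) (x, y)) =
          ∫ x in φ y..ε, (1 : ℝ) := by
        refine intervalIntegral.integral_congr_ae ?_
        filter_upwards [(compl_mem_ae_iff.2 (measure_singleton ε) : ({ε} : Set ℝ)ᶜ ∈ ae volume)]
          with x hx hx'
        rw [uIoc_of_le ((h0 y).trans hε.le)] at hx'
        rw [gradSq_sliceExt_of_lt g y₀ y (lt_of_le_of_ne hx'.2 hx)]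
        simp
      rw [this]
      simp only [intervalIntegral.integral_const, smul_eq_mul, mul_one]
      linarith [hm y]
    · refine intervalIntegral.integral_mono_ae_restrict hε1 (intervalIntegrable_slice hwm hwM y _ _)
        (intervalIntegrable_slice hgm hgM y₀ _ _) ?_
      rw [Filter.EventuallyLE, ← restrict_Ioc_eq_restrict_Icc, ae_restrict_iff' measurableSet_Ioc]
      filter_upwards [hy₀] with x hd hx
      exact Real.sqrt_le_sqrt (add_le_add_right (gradSq_sliceExt_le_of_gt y hx.1 hd) 1)
  have hint := intervalIntegral.integral_mono_on hε.le
    (intervalIntegrable_integral_slice hwm hwM hφ continuous_const 0 ε)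
    (intervalIntegrable_const (c := ε * (1 + H) + ∫ x in ε..1, Real.sqrt (1 + gradSq g (x, y₀))))
    fun y _ => hinner y
  simp only [intervalIntegral.integral_const, sub_zero, smul_eq_mul] at hint
  have hfac := mul_le_mul_of_nonneg_left hint (by positivity : 0 ≤ 1 / ε)
  rw [← mul_assoc (1 / ε) ε, one_div_mul_cancel hε.ne', one_mul] at hfac
  rw [mul_left_comm (1 / ε) (g (ε, y₀))]
  linarith

theorem integral_abs_sub_const_le {ε : ℝ} {φ : ℝ → ℝ} {g : ℝ × ℝ → ℝ} {K : NNReal}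
    (hg : LipschitzWith K g) (hper : ∀ x y : ℝ, g (x, y + ε) = g (x, y))
    (hφ : Continuous φ) (h0 : ∀ y, φ y ≤ 0) (hε : 0 < ε) {m : ℝ}
    (hmean : ∫ y in (0 : ℝ)..ε, g (ε, y) = ε * m) :
    ∫ y in (0 : ℝ)..ε, |g (φ y, y) - m| ≤
      ∫ y in (0 : ℝ)..ε, ∫ x in φ y..ε, Real.sqrt (1 + gradSq g (x, y)) := by
  have hc := hg.continuous
  have hgm := measurable_sqrt_gradSq g
  have hgM := abs_sqrt_gradSq_le hg
  have hp : Function.Periodic (fun y => g (ε, y)) ε := fun y => hper ε y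
  have hadd : ∀ y, ∫ s in (0 : ℝ)..ε, g (ε, y + s) = ε * m := fun y => by
    rw [intervalIntegral.integral_comp_add_left (fun s => g (ε, s)), ← hmean]
    simpa using hp.intervalIntegral_add_eq y 0
  have hsub : ∀ y, ∫ s in (0 : ℝ)..ε, g (ε, y - s) = ε * m := fun y => by
    rw [intervalIntegral.integral_comp_sub_left (fun s => g (ε, s)), ← hmean]
    simpa using hp.intervalIntegral_add_eq (y - ε) 0
  set B : ℝ → ℝ → ℝ := fun y s =>
    |g (φ y, y) - g (ε, y + s)| + |g (φ y, y) - g (ε, y - s)| with hB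
  have hBc : Continuous (Function.uncurry B) := by
    simp only [hB, Function.uncurry_def]
    fun_prop
  have hpt : ∀ y, 2 * ε * |g (φ y, y) - m| ≤ ∫ s in (0 : ℝ)..ε, B y s := by
    intro y
    have h1 : ∫ s in (0 : ℝ)..ε, ((g (φ y, y) - g (ε, y + s)) + (g (φ y, y) - g (ε, y - s))) =
        2 * ε * (g (φ y, y) - m) := by
      rw [intervalIntegral.integral_add (Continuous.intervalIntegrable (by fun_prop) _ _)
        (Continuous.intervalIntegrable (by fun_prop) _ _),
        intervalIntegral.integral_sub (Continuous.intervalIntegrable (by fun_prop) _ _)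
        (Continuous.intervalIntegrable (by fun_prop) _ _),
        intervalIntegral.integral_sub (Continuous.intervalIntegrable (by fun_prop) _ _)
        (Continuous.intervalIntegrable (by fun_prop) _ _), hadd, hsub]
      simp only [intervalIntegral.integral_const, sub_zero, smul_eq_mul]
      ring
    have h2 : 2 * ε * |g (φ y, y) - m| = |2 * ε * (g (φ y, y) - m)| := by
      rw [abs_mul, abs_of_pos (by positivity : 0 < 2 * ε)]
    rw [h2, ← h1]
    refine (intervalIntegral.abs_integral_le_integral_abs hε.le).trans ?_
    exact intervalIntegral.integral_mono_on hε.le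
      (Continuous.intervalIntegrable (by fun_prop) _ _)
      (Continuous.intervalIntegrable (by fun_prop) _ _) fun s _ => abs_add_le _ _
  have hG := integral_slice_add hgm hgM hφ (continuous_const (y := (0 : ℝ)))
    (continuous_const (y := ε)) 0 ε
  set G := ∫ y in (0 : ℝ)..ε, ∫ x in φ y..ε, Real.sqrt (1 + gradSq g (x, y))
  have hleft : ∫ y in (0 : ℝ)..ε, |g (0, y) - g (φ y, y)| ≤
      ∫ y in (0 : ℝ)..ε, ∫ x in φ y..0, Real.sqrt (1 + gradSq g (x, y)) :=
    integral_abs_sub_le_sqrt_gradSq hg hφ (continuous_const (y := (0 : ℝ))) h0 hε.le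
  have hslice : ∀ s ∈ Icc 0 ε, ∫ y in (0 : ℝ)..ε, B y s ≤ 2 * G := by
    intro s hs
    have hσ : |s / ε| ≤ 1 := by
      rw [abs_of_nonneg (div_nonneg hs.1 hε.le)]
      exact (div_le_one hε).2 hs.2
    have h1 := integral_abs_sub_shear_le hg hε.le hper (s / ε)
    have h2 := integral_abs_sub_shear_le hg hε.le hper (-(s / ε))
    simp only [neg_mul, div_mul_cancel₀ _ hε.ne', ← sub_eq_add_neg] at h1 h2
    have hmeas : ∀ σ, Measurable fun p => |pdx g p + σ * pdy g p| := fun σ =>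
      ((measurable_pdx g).add ((measurable_pdy g).const_mul σ)).abs
    have hmeas' : ∀ σ, Measurable fun p => |pdx g p - σ * pdy g p| := fun σ =>
      ((measurable_pdx g).sub ((measurable_pdy g).const_mul σ)).abs
    have hbd : ∀ p, |pdx g p + s / ε * pdy g p| + |pdx g p - s / ε * pdy g p| ≤
        2 * Real.sqrt (1 + ((K : ℝ) ^ 2 + (K : ℝ) ^ 2)) := fun p =>
      (abs_add_abs_sub_le_sqrt_gradSq g p hσ).trans
        (mul_le_mul_of_nonneg_left ((le_abs_self _).trans (hgM p)) zero_le_two)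
    have hb1 : ∀ p, |(|pdx g p + s / ε * pdy g p|)| ≤
        2 * Real.sqrt (1 + ((K : ℝ) ^ 2 + (K : ℝ) ^ 2)) := fun p => by
      rw [abs_abs]
      linarith [hbd p, abs_nonneg (pdx g p - s / ε * pdy g p)]
    have hb2 : ∀ p, |(|pdx g p - s / ε * pdy g p|)| ≤
        2 * Real.sqrt (1 + ((K : ℝ) ^ 2 + (K : ℝ) ^ 2)) := fun p => by
      rw [abs_abs]
      linarith [hbd p, abs_nonneg (pdx g p + s / ε * pdy g p)]
    have h3 : (∫ y in (0 : ℝ)..ε, ∫ x in (0 : ℝ)..ε, |pdx g (x, y) + s / ε * pdy g (x, y)|) +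
        (∫ y in (0 : ℝ)..ε, ∫ x in (0 : ℝ)..ε, |pdx g (x, y) - s / ε * pdy g (x, y)|) ≤
        2 * ∫ y in (0 : ℝ)..ε, ∫ x in (0 : ℝ)..ε, Real.sqrt (1 + gradSq g (x, y)) := by
      have i1 := intervalIntegrable_integral_slice (hmeas (s / ε)) hb1
        (continuous_const (y := (0 : ℝ))) (continuous_const (y := ε)) 0 ε
      have i2 := intervalIntegrable_integral_slice (hmeas' (s / ε)) hb2
        (continuous_const (y := (0 : ℝ))) (continuous_const (y := ε)) 0 ε
      have i3 := intervalIntegrable_integral_slice hgm hgM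
        (continuous_const (y := (0 : ℝ))) (continuous_const (y := ε)) 0 ε
      rw [← intervalIntegral.integral_add i1 i2, ← intervalIntegral.integral_const_mul]
      refine intervalIntegral.integral_mono_on hε.le (i1.add i2) (i3.const_mul 2) fun y _ => ?_
      have j1 := intervalIntegrable_slice (hmeas (s / ε)) hb1 y 0 ε
      have j2 := intervalIntegrable_slice (hmeas' (s / ε)) hb2 y 0 ε
      rw [← intervalIntegral.integral_add j1 j2, ← intervalIntegral.integral_const_mul]
      exact intervalIntegral.integral_mono_on hε.le (j1.add j2)
        ((intervalIntegrable_slice hgm hgM y 0 ε).const_mul 2)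
        fun x _ => abs_add_abs_sub_le_sqrt_gradSq g (x, y) hσ
    have hsplit : ∫ y in (0 : ℝ)..ε, B y s ≤
        2 * (∫ y in (0 : ℝ)..ε, |g (0, y) - g (φ y, y)|) +
        ((∫ y in (0 : ℝ)..ε, |g (ε, y + s) - g (0, y)|) +
          ∫ y in (0 : ℝ)..ε, |g (ε, y - s) - g (0, y)|) := by
      rw [← intervalIntegral.integral_const_mul, ← intervalIntegral.integral_add
        (Continuous.intervalIntegrable (by fun_prop) _ _)
        (Continuous.intervalIntegrable (by fun_prop) _ _), ← intervalIntegral.integral_add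
        (Continuous.intervalIntegrable (by fun_prop) _ _)
        (Continuous.intervalIntegrable (by fun_prop) _ _)]
      refine intervalIntegral.integral_mono_on hε.le
        (Continuous.intervalIntegrable (by fun_prop) _ _)
        (Continuous.intervalIntegrable (by fun_prop) _ _) fun y _ => ?_
      have t1 := abs_sub_le (g (ε, y + s)) (g (0, y)) (g (φ y, y))
      have t2 := abs_sub_le (g (ε, y - s)) (g (0, y)) (g (φ y, y))
      simp only [hB]
      rw [abs_sub_comm (g (φ y, y)), abs_sub_comm (g (φ y, y))]
      linarith
    linarith
  have hswap : ∫ y in (0 : ℝ)..ε, ∫ s in (0 : ℝ)..ε, B y s =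
      ∫ s in (0 : ℝ)..ε, ∫ y in (0 : ℝ)..ε, B y s := by
    refine intervalIntegral_intervalIntegral_swap ?_
    rw [uIoc_of_le hε.le]
    exact (hBc.continuousOn.integrableOn_compact (isCompact_Icc.prod isCompact_Icc)).mono_set
      (prod_mono Ioc_subset_Icc_self Ioc_subset_Icc_self)
  have hy : 2 * ε * ∫ y in (0 : ℝ)..ε, |g (φ y, y) - m| ≤
      ∫ y in (0 : ℝ)..ε, ∫ s in (0 : ℝ)..ε, B y s := by
    rw [← intervalIntegral.integral_const_mul]
    exact intervalIntegral.integral_mono_on hε.le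
      (Continuous.intervalIntegrable (by fun_prop) _ _)
      (Continuous.intervalIntegrable
        (intervalIntegral.continuous_parametric_intervalIntegral_of_continuous' hBc 0 ε) _ _)
      fun y _ => hpt y
  have hBc' : Continuous (Function.uncurry fun s y => B y s) := hBc.comp continuous_swap
  have hs : ∫ s in (0 : ℝ)..ε, ∫ y in (0 : ℝ)..ε, B y s ≤ ∫ s in (0 : ℝ)..ε, 2 * G :=
    intervalIntegral.integral_mono_on hε.le
      (Continuous.intervalIntegrable
        (intervalIntegral.continuous_parametric_intervalIntegral_of_continuous' hBc' 0 ε) _ _)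
      intervalIntegrable_const hslice
  simp only [intervalIntegral.integral_const, sub_zero, smul_eq_mul] at hs
  have : 2 * ε * ∫ y in (0 : ℝ)..ε, |g (φ y, y) - m| ≤ 2 * ε * G := by linarith
  exact le_of_mul_le_mul_left this (by positivity)

theorem memV_sliceExt {ε : ℝ} {φ : ℝ → ℝ} {g : ℝ × ℝ → ℝ} {K : NNReal}
    (hg : LipschitzWith K g) (hg1 : ∀ y, g (1, y) = 0) (hε1 : ε ≤ 1) (y₀ : ℝ) :
    memV ε φ (sliceExt ε g y₀) :=
  ⟨⟨K, (lipschitzWith_sliceExt hg ε y₀).lipschitzOnWith⟩, fun _ _ => rfl, fun _ => by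
    simp only [sliceExt, max_eq_left hε1, hg1]⟩

theorem boundary_trace_estimate_of_lipschitzWith {ε ν H C : ℝ} {φ c : ℝ → ℝ} {g : ℝ × ℝ → ℝ}
    {K : NNReal} (hctx : Ctx ε ν H φ c) (hg : LipschitzWith K g) (hgV : memV ε φ g)
    (hC : ∀ w, memV ε φ w → C ≤ En ε φ c w) :
    (1 / ε) * (∫ y in Ioo (0 : ℝ) ε, |g (φ y, y) - ybar ε g 0|) ≤
      (2 / (1 - ν)) * ((1 + H) * ε + En ε φ c g - C) := by
  obtain ⟨⟨hε, hε1⟩, ⟨hν0, hν1⟩, -, hφ1, -, hm, h0, hcc, -, hν⟩ := hctx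
  obtain ⟨-, hper, hg1⟩ := hgV
  have hφ := hφ1.continuous
  have hc := hg.continuous
  have hdc : Continuous (deriv φ) := hφ1.continuous_deriv le_rfl
  set k : ℝ → ℝ := fun y => c y * Real.sqrt (1 + (deriv φ y) ^ 2) with hkdef
  have hk : Continuous k := by fun_prop
  have hkν : ∀ y, |k y| ≤ ν := fun y => by
    rw [hkdef, abs_mul, abs_of_nonneg (Real.sqrt_nonneg _)]
    exact hν y
  have hφ_le : ∀ {a : ℝ}, 0 ≤ a → ∀ y, φ y ≤ a := fun ha y => (h0 y).trans ha
  have hgm := measurable_sqrt_gradSq g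
  have hgM := abs_sqrt_gradSq_le hg
  have hybar : ∀ x, ∫ y in (0 : ℝ)..ε, g (x, y) = ε * ybar ε g x := fun x => by
    rw [ybar, intervalIntegral.integral_of_le hε.le, integral_Ioc_eq_integral_Ioo, ← mul_assoc,
      mul_one_div_cancel hε.ne', one_mul]
  have hE := En_eq (c := c) hg hφ hm (hφ_le zero_le_one) hε.le
  rw [integral_slice_add hgm hgM hφ (continuous_const (y := ε)) (continuous_const (y := 1))] at hE
  set G := ∫ y in (0 : ℝ)..ε, ∫ x in φ y..ε, Real.sqrt (1 + gradSq g (x, y))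
  set R := ∫ y in (0 : ℝ)..ε, ∫ x in ε..1, Real.sqrt (1 + gradSq g (x, y))
  set T := ∫ y in (0 : ℝ)..ε, g (φ y, y) * k y
  set κ := ∫ y in (0 : ℝ)..ε, k y
  have hB : ∫ y in (0 : ℝ)..ε, |g (φ y, y) - ybar ε g ε| ≤ G :=
    integral_abs_sub_const_le hg hper hφ h0 hε (hybar ε)
  have hmeans : ε * |ybar ε g ε - ybar ε g 0| ≤ G := by
    have h1 : ε * |ybar ε g ε - ybar ε g 0| ≤ ∫ y in (0 : ℝ)..ε, |g (ε, y) - g (0, y)| := by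
      rw [← abs_of_pos hε, ← abs_mul, abs_of_pos hε, mul_sub, ← hybar, ← hybar,
        ← intervalIntegral.integral_sub (Continuous.intervalIntegrable (by fun_prop) _ _)
          (Continuous.intervalIntegrable (by fun_prop) _ _)]
      exact intervalIntegral.abs_integral_le_integral_abs hε.le
    have h2 := integral_abs_sub_le_sqrt_gradSq hg (continuous_const (y := (0 : ℝ)))
      (continuous_const (y := ε)) (fun _ => hε.le) hε.le
    have h3 := integral_slice_add hgm hgM hφ (continuous_const (y := (0 : ℝ)))
      (continuous_const (y := ε)) 0 ε
    have h4 := integral_slice_nonneg (F := fun p => Real.sqrt (1 + gradSq g p))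
      (fun p => Real.sqrt_nonneg _) h0 hε.le
    linarith
  have htrace : ∫ y in (0 : ℝ)..ε, |g (φ y, y) - ybar ε g 0| ≤ 2 * G := by
    have : ∫ y in (0 : ℝ)..ε, |g (φ y, y) - ybar ε g 0| ≤
        ∫ y in (0 : ℝ)..ε, (|g (φ y, y) - ybar ε g ε| + |ybar ε g ε - ybar ε g 0|) :=
      intervalIntegral.integral_mono_on hε.le (Continuous.intervalIntegrable (by fun_prop) _ _)
        (Continuous.intervalIntegrable (by fun_prop) _ _) fun y _ => abs_sub_le _ _ _
    rw [intervalIntegral.integral_add (Continuous.intervalIntegrable (by fun_prop) _ _)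
      intervalIntegrable_const] at this
    simp only [intervalIntegral.integral_const, sub_zero, smul_eq_mul] at this
    linarith
  have hcontact : T - ybar ε g ε * κ ≤ ν * G := by
    have h1 := integral_mul_le_of_abs_le (f := fun y => g (φ y, y) - ybar ε g ε) (by fun_prop)
      hk hkν hε.le
    simp only [sub_mul] at h1
    rw [intervalIntegral.integral_sub (Continuous.intervalIntegrable (by fun_prop) _ _)
      (Continuous.intervalIntegrable (by fun_prop) _ _),
      intervalIntegral.integral_const_mul] at h1
    exact h1.trans (mul_le_mul_of_nonneg_left hB hν0)
  have hcompare : ε * C ≤ ε * (ε * (1 + H)) + R - ybar ε g ε * κ := by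
    have hiR : IntervalIntegrable (fun y => ∫ x in ε..1, Real.sqrt (1 + gradSq g (x, y)))
        volume 0 ε :=
      intervalIntegrable_integral_slice hgm hgM continuous_const continuous_const 0 ε
    have hig : IntervalIntegrable (fun y => g (ε, y) * ((1 / ε) * κ)) volume 0 ε :=
      Continuous.intervalIntegrable (by fun_prop) _ _
    have h1 : ∫ y in (0 : ℝ)..ε, C ≤ ∫ y in (0 : ℝ)..ε, (ε * (1 + H) +
        (∫ x in ε..1, Real.sqrt (1 + gradSq g (x, y))) - g (ε, y) * ((1 / ε) * κ)) := by
      refine intervalIntegral.integral_mono_ae hε.le intervalIntegrable_const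
        ((intervalIntegrable_const.add hiR).sub hig) ?_
      filter_upwards [ae_En_sliceExt_le (c := c) hg hφ hm h0 hε hε1] with y hy
      exact (hC _ (memV_sliceExt hg hg1 hε1 y)).trans hy
    rw [intervalIntegral.integral_sub (intervalIntegrable_const.add hiR) hig,
      intervalIntegral.integral_add intervalIntegrable_const hiR,
      intervalIntegral.integral_mul_const (μ := volume) (1 / ε * κ) (fun y => g (ε, y)),
      hybar] at h1
    simp only [intervalIntegral.integral_const, sub_zero, smul_eq_mul] at h1
    have h2 : ε * ybar ε g ε * (1 / ε * κ) = ybar ε g ε * κ := by field_simp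
    linarith
  have hεE : ε * En ε φ c g = G + R - T := by
    rw [hE]
    field_simp
  rw [← integral_Ioc_eq_integral_Ioo, ← intervalIntegral.integral_of_le hε.le,
    div_mul_eq_mul_div, one_mul, div_mul_eq_mul_div, div_le_div_iff₀ hε (by linarith)]
  have hmul := mul_le_mul_of_nonneg_right htrace (by linarith : (0 : ℝ) ≤ 1 - ν)
  linarith

/-- Lemma 5.3: with `C_ε = inf_{v ∈ V} 𝓔(v)`, for every `v ∈ V`,
`(1/ε)∫₀^ε |v(φ(y),y) − v̄(0)| dy ≤ (2/(1−ν))((1+H)ε + 𝓔(v) − C_ε)`. -/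
theorem boundary_trace_estimate
    (ε ν H : ℝ) (φ c : ℝ → ℝ) (hctx : Ctx ε ν H φ c)
    (Cε : ℝ) (hCε : Cε = sInf (En ε φ c '' {v : ℝ × ℝ → ℝ | memV ε φ v}))
    (v : ℝ × ℝ → ℝ) (hv : memV ε φ v) :
    (1 / ε) * (∫ y in Ioo (0 : ℝ) ε, |v (φ y, y) - ybar ε v 0|) ≤
      (2 / (1 - ν)) * ((1 + H) * ε + En ε φ c v - Cε) := by
  obtain ⟨⟨hε, -⟩, ⟨-, hν1⟩, -, hφ1, hφper, hm, h0, hcc, -, hν⟩ := id hctx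
  have hφ := hφ1.continuous
  have h1 : ∀ y, φ y ≤ 1 := fun y => (h0 y).trans zero_le_one
  have hdc : Continuous (deriv φ) := hφ1.continuous_deriv le_rfl
  have hbdd : BddBelow (En ε φ c '' {v : ℝ × ℝ → ℝ | memV ε φ v}) := by
    refine ⟨0, ?_⟩
    rintro _ ⟨w, hw, rfl⟩
    obtain ⟨K, g, hg, hgV, hgw⟩ := exists_lipschitzWith_of_memV hε.ne' hφ1 hφper h1 hw
    rw [← En_congr hφ h1 hgw]
    refine En_nonneg hg hgV.2.2 hφ hm h1 hε.le (by fun_prop) (fun y => ?_) hν1.le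
    rw [abs_mul, abs_of_nonneg (Real.sqrt_nonneg _)]
    exact hν y
  obtain ⟨K, g, hg, hgV, hgv⟩ := exists_lipschitzWith_of_memV hε.ne' hφ1 hφper h1 hv
  have h := boundary_trace_estimate_of_lipschitzWith hctx hg hgV fun w hw =>
    hCε.trans_le (csInf_le hbdd (mem_image_of_mem _ hw))
  have hb : ∀ y, g (φ y, y) = v (φ y, y) := fun y => hgv ⟨le_rfl, h1 y⟩
  have h00 : ∀ y, g (0, y) = v (0, y) := fun y => hgv ⟨h0 y, zero_le_one⟩
  simpa only [ybar, hb, h00, En_congr hφ h1 hgv] using h
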